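/- Fix R₁ > 0. Then the map R₂ ↦ λ₁(M_{R₁,R₂}) is strictly decreasing on (R₁, ∞): if R₁ < R₂ < R₂' then λ₁(M_{R₁,R₂'}) < λ₁(M_{R₁,R₂}). -/

import Mathlib

open MeasureTheory Real Set

noncomputable section

/-- A Dirichlet test function on `ω`: smooth, compactly supported, with support in `ω`. -/
def testFun (ω : Set (ℝ × ℝ)) (u : (ℝ × ℝ) → ℝ) : Prop :=
  ContDiff ℝ (⊤ : ℕ∞) u ∧ HasCompactSupport u ∧ tsupport u ⊆ ω

/-- `|∇u|²` at a point. -/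
def gradSq (u : (ℝ × ℝ) → ℝ) (x : ℝ × ℝ) : ℝ :=
  fderiv ℝ u x (1, 0) ^ 2 + fderiv ℝ u x (0, 1) ^ 2

/-- The Rayleigh quotient of `u` on `ω`. -/
def rayleigh (ω : Set (ℝ × ℝ)) (u : (ℝ × ℝ) → ℝ) : ℝ :=
  (∫ x in ω, gradSq u x) / ∫ x in ω, u x ^ 2

/-- The `k`-th Dirichlet eigenvalue of `ω` (`k ≥ 1`), via the Courant–Fischer
min-max formula over `k`-dimensional subspaces of `C_c^∞(ω)`. -/
def dirichletEV (ω : Set (ℝ × ℝ)) (k : ℕ) : ℝ :=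
  sInf {l | ∃ V : Submodule ℝ ((ℝ × ℝ) → ℝ),
    (V : Set ((ℝ × ℝ) → ℝ)) ⊆ {u | testFun ω u} ∧ Module.finrank ℝ V = k ∧
    l = sSup {r | ∃ u ∈ V, u ≠ 0 ∧ r = rayleigh ω u}}

/-- The open disk `B_R` centered at the origin. -/
def disk (R : ℝ) : Set (ℝ × ℝ) := {x | x.1 ^ 2 + x.2 ^ 2 < R ^ 2}

/-- The open annulus `M_{R₁,R₂} = B_{R₂} \ closure (B_{R₁})`. -/
def annulus (R₁ R₂ : ℝ) : Set (ℝ × ℝ) := disk R₂ \ closure (disk R₁)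

/-- `D_{R₁,R₂} = B_{R₁} ∪ M_{R₁,R₂}`. -/
def diskUnionAnnulus (R₁ R₂ : ℝ) : Set (ℝ × ℝ) := disk R₁ ∪ annulus R₁ R₂

/-- The cracked domain `𝔇(N,ε)`. -/
def crackedDomain (R₁ R₂ : ℝ) (N : ℕ) (ε : ℝ) : Set (ℝ × ℝ) :=
  diskUnionAnnulus R₁ R₂ ∪
    ⋃ j ∈ Finset.range N, {x | ∃ θ : ℝ, θ ∈ Set.Ioo (2 * π * j / N - ε) (2 * π * j / N + ε) ∧
      x = (R₁ * Real.cos θ, R₁ * Real.sin θ)}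

/-- The first Dirichlet eigenvalue of `ω`: the infimum of the Rayleigh quotient over
nonzero functions in `C_c^∞(ω)`. -/
def lambda1 (ω : Set (ℝ × ℝ)) : ℝ :=
  sInf {r | ∃ u, testFun ω u ∧ u ≠ 0 ∧ r = rayleigh ω u}

theorem testFun.integral_sq {ω : Set (ℝ × ℝ)} {u : ℝ × ℝ → ℝ} (hu : testFun ω u) :
    ∫ x in ω, u x ^ 2 = ∫ x, u x ^ 2 := by
  refine setIntegral_eq_integral_of_forall_compl_eq_zero fun x hx => ?_
  rw [image_eq_zero_of_notMem_tsupport fun h => hx (hu.2.2 h)]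
  simp

theorem gradSq_eq_zero_of_notMem_tsupport {u : ℝ × ℝ → ℝ} {x : ℝ × ℝ} (hx : x ∉ tsupport u) :
    gradSq u x = 0 := by
  have h : fderiv ℝ u x = 0 := by
    by_contra h
    exact hx (support_fderiv_subset ℝ h)
  simp [gradSq, h]

theorem testFun.integral_gradSq {ω : Set (ℝ × ℝ)} {u : ℝ × ℝ → ℝ} (hu : testFun ω u) :
    ∫ x in ω, gradSq u x = ∫ x, gradSq u x :=
  setIntegral_eq_integral_of_forall_compl_eq_zero fun _ hx =>
    gradSq_eq_zero_of_notMem_tsupport fun h => hx (hu.2.2 h)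

theorem testFun.rayleigh_eq {ω : Set (ℝ × ℝ)} {u : ℝ × ℝ → ℝ} (hu : testFun ω u) :
    rayleigh ω u = (∫ x, gradSq u x) / ∫ x, u x ^ 2 := by
  rw [rayleigh, hu.integral_sq, hu.integral_gradSq]

theorem gradSq_nonneg (u : ℝ × ℝ → ℝ) (x : ℝ × ℝ) : 0 ≤ gradSq u x := by
  unfold gradSq; positivity

theorem rayleigh_nonneg (ω : Set (ℝ × ℝ)) (u : ℝ × ℝ → ℝ) : 0 ≤ rayleigh ω u :=
  div_nonneg (integral_nonneg (gradSq_nonneg u)) (integral_nonneg fun _ => sq_nonneg _)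

theorem testFun.integral_sq_pos {ω : Set (ℝ × ℝ)} {u : ℝ × ℝ → ℝ} (hu : testFun ω u)
    (h0 : u ≠ 0) : 0 < ∫ x, u x ^ 2 := by
  obtain ⟨x, hx⟩ := Function.ne_iff.1 h0
  have hc := hu.1.continuous
  refine (hc.pow 2).integral_pos_of_hasCompactSupport_nonneg_nonzero ?_ (fun _ => sq_nonneg _)
    (x := x) (pow_ne_zero 2 hx)
  exact hu.2.1.comp_left (g := fun y : ℝ => y ^ 2) (by simp)

theorem testFun.continuous_fderiv_apply {ω : Set (ℝ × ℝ)} {u : ℝ × ℝ → ℝ} (hu : testFun ω u)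
    (v : ℝ × ℝ) : Continuous fun x => fderiv ℝ u x v :=
  (hu.1.continuous_fderiv (by simp)).clm_apply continuous_const

theorem testFun.integrable_gradSq {ω : Set (ℝ × ℝ)} {u : ℝ × ℝ → ℝ} (hu : testFun ω u) :
    Integrable (gradSq u) := by
  have h1 := hu.continuous_fderiv_apply (1, 0)
  have h2 := hu.continuous_fderiv_apply (0, 1)
  refine Continuous.integrable_of_hasCompactSupport ((h1.pow 2).add (h2.pow 2)) ?_
  exact HasCompactSupport.intro hu.2.1 fun x hx => gradSq_eq_zero_of_notMem_tsupport hx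

theorem testFun.integral_sq_eq {ω : Set (ℝ × ℝ)} {u : ℝ × ℝ → ℝ} (hu : testFun ω u) :
    ∫ x, u x ^ 2 = -∫ x : ℝ × ℝ, x.1 * (2 * u x * fderiv ℝ u x (1, 0)) := by
  have hc := hu.1.continuous
  have hd : Differentiable ℝ u := hu.1.differentiable (by simp)
  have hD : ∀ x, fderiv ℝ (fun x => u x ^ 2) x (1, 0) = 2 * u x * fderiv ℝ u x (1, 0) := by
    intro x
    rw [((hd x).hasFDerivAt.pow 2).fderiv]
    simp
  have h1 := hu.continuous_fderiv_apply (1, 0)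
  have hi : ∀ f : ℝ × ℝ → ℝ, Continuous f → (∀ x, u x = 0 → f x = 0) → Integrable f := by
    intro f hf h
    refine hf.integrable_of_hasCompactSupport (HasCompactSupport.intro hu.2.1 fun x hx => ?_)
    exact h x (image_eq_zero_of_notMem_tsupport hx)
  have key := integral_mul_fderiv_eq_neg_fderiv_mul_of_integrable (𝕜 := ℝ)
    (μ := (volume : Measure (ℝ × ℝ))) (f := fun x : ℝ × ℝ => x.1) (g := fun x => u x ^ 2)
    (v := (1, 0)) ?_ ?_ ?_
    (fun x _ => differentiableAt_fst) (fun x _ => (hd x).pow 2)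
  · simp only [hD, fderiv_fst, ContinuousLinearMap.coe_fst', one_mul] at key
    linarith
  · simp only [fderiv_fst, ContinuousLinearMap.coe_fst', one_mul]
    exact hi _ (by fun_prop) (by simp +contextual)
  · simp only [hD]
    exact hi _ (by fun_prop) (by simp +contextual)
  · exact hi _ (by fun_prop) (by simp +contextual)

/-- Poincaré inequality in a strip of half-width `R`. -/
theorem testFun.poincare {ω : Set (ℝ × ℝ)} {u : ℝ × ℝ → ℝ} (hu : testFun ω u) {R : ℝ}
    (hω : ∀ x ∈ ω, x.1 ^ 2 ≤ R ^ 2) :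
    ∫ x, u x ^ 2 ≤ 4 * R ^ 2 * ∫ x, gradSq u x := by
  have hc := hu.1.continuous
  have hsq : Integrable fun x => u x ^ 2 :=
    (hc.pow 2).integrable_of_hasCompactSupport
      (HasCompactSupport.intro hu.2.1 fun x hx => by
        simp [image_eq_zero_of_notMem_tsupport hx])
  have hle : ∫ x : ℝ × ℝ, -(x.1 * (2 * u x * fderiv ℝ u x (1, 0))) ≤
      ∫ x, (1 / 2 * u x ^ 2 + 2 * R ^ 2 * gradSq u x) := by
    have h1 := hu.continuous_fderiv_apply (1, 0)
    have hl : Continuous fun x : ℝ × ℝ => -(x.1 * (2 * u x * fderiv ℝ u x (1, 0))) :=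
      (continuous_fst.mul ((continuous_const.mul hc).mul h1)).neg
    have hli := hl.integrable_of_hasCompactSupport (μ := volume)
      (HasCompactSupport.intro hu.2.1 fun x hx => by
        simp [image_eq_zero_of_notMem_tsupport hx])
    refine integral_mono hli ((hsq.const_mul (1 / 2)).add (hu.integrable_gradSq.const_mul (2 * R ^ 2))) ?_
    · intro x
      by_cases hx : x ∈ tsupport u
      · have hR := hω x (hu.2.2 hx)
        simp only [gradSq]
        nlinarith [sq_nonneg (u x + 2 * x.1 * fderiv ℝ u x (1, 0)),
          mul_le_mul_of_nonneg_right hR (sq_nonneg (fderiv ℝ u x (1, 0))),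
          mul_nonneg (sq_nonneg R) (sq_nonneg (fderiv ℝ u x (0, 1)))]
      · simp [image_eq_zero_of_notMem_tsupport hx, gradSq_eq_zero_of_notMem_tsupport hx]
  rw [integral_neg, ← hu.integral_sq_eq,
    integral_add (hsq.const_mul _) (hu.integrable_gradSq.const_mul _),
    integral_const_mul, integral_const_mul] at hle
  linarith

theorem isOpen_disk (R : ℝ) : IsOpen (disk R) :=
  isOpen_lt (by fun_prop) continuous_const

theorem isOpen_annulus (R₁ R₂ : ℝ) : IsOpen (annulus R₁ R₂) :=
  (isOpen_disk R₂).sdiff isClosed_closure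

theorem annulus_nonempty {R₁ R₂ : ℝ} (h₁ : 0 < R₁) (h : R₁ < R₂) : (annulus R₁ R₂).Nonempty := by
  refine ⟨((R₁ + R₂) / 2, 0), ?_, fun hx => ?_⟩
  · simp only [disk, mem_ofPred_eq]
    nlinarith
  · have hcl : closure (disk R₁) ⊆ {x : ℝ × ℝ | x.1 ^ 2 + x.2 ^ 2 ≤ R₁ ^ 2} :=
      closure_minimal (fun x hx => by
        have h : x.1 ^ 2 + x.2 ^ 2 < R₁ ^ 2 := hx
        exact h.le) (isClosed_le (by fun_prop) continuous_const)
    have := hcl hx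
    simp only [mem_ofPred_eq] at this
    nlinarith

theorem exists_testFun_ne_zero {ω : Set (ℝ × ℝ)} (ho : IsOpen ω) (hne : ω.Nonempty) :
    ∃ u, testFun ω u ∧ u ≠ 0 := by
  obtain ⟨x, hx⟩ := hne
  obtain ⟨u, hs, hcs, hcd, -, h1⟩ :=
    exists_contDiff_tsupport_subset (n := (⊤ : ℕ∞)) (ho.mem_nhds hx)
  refine ⟨u, ⟨hcd, hcs, hs⟩, fun h => ?_⟩
  simp [h] at h1

theorem lambda1_le_rayleigh {ω : Set (ℝ × ℝ)} {u : ℝ × ℝ → ℝ} (hu : testFun ω u) (h0 : u ≠ 0) :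
    lambda1 ω ≤ rayleigh ω u := by
  refine csInf_le ⟨0, ?_⟩ ⟨u, hu, h0, rfl⟩
  rintro _ ⟨v, -, -, rfl⟩
  exact rayleigh_nonneg ω v

theorem le_lambda1 {ω : Set (ℝ × ℝ)} (ho : IsOpen ω) (hne : ω.Nonempty) {c : ℝ}
    (h : ∀ u, testFun ω u → u ≠ 0 → c ≤ rayleigh ω u) : c ≤ lambda1 ω := by
  obtain ⟨u, hu, h0⟩ := exists_testFun_ne_zero ho hne
  refine le_csInf ⟨_, u, hu, h0, rfl⟩ ?_
  rintro _ ⟨v, hv, hv0, rfl⟩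
  exact h v hv hv0

theorem lambda1_annulus_pos {R₁ R₂ : ℝ} (h₁ : 0 < R₁) (h : R₁ < R₂) :
    0 < lambda1 (annulus R₁ R₂) := by
  have hR : 0 < R₂ := h₁.trans h
  have hc : 0 < 1 / (4 * R₂ ^ 2) := by positivity
  refine hc.trans_le (le_lambda1 (isOpen_annulus _ _) (annulus_nonempty h₁ h) fun u hu h0 => ?_)
  rw [hu.rayleigh_eq, div_le_div_iff₀ (by positivity) (hu.integral_sq_pos h0)]
  have := hu.poincare (R := R₂) fun x hx => by
    have hx' : x.1 ^ 2 + x.2 ^ 2 < R₂ ^ 2 := hx.1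
    nlinarith [sq_nonneg x.2]
  linarith

theorem gradSq_comp_smul (u : ℝ × ℝ → ℝ) (s : ℝ) (x : ℝ × ℝ) :
    gradSq (fun y => u (s • y)) x = s ^ 2 * gradSq u (s • x) := by
  simp only [gradSq, fderiv_comp_smul, smul_apply, smul_eq_mul]
  ring

theorem testFun.comp_smul {ω ω' : Set (ℝ × ℝ)} {u : ℝ × ℝ → ℝ} (hu : testFun ω u) {s : ℝ}
    (hs : s ≠ 0) (hω : ∀ x, s • x ∈ ω → x ∈ ω') : testFun ω' fun x => u (s • x) := by
  refine ⟨hu.1.comp (contDiff_const_smul s), ?_, fun x hx => hω x (hu.2.2 ?_)⟩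
  · exact hu.2.1.comp_homeomorph (Homeomorph.smulOfNeZero s hs)
  · exact tsupport_comp_subset_preimage u (continuous_const_smul s) hx

theorem testFun.rayleigh_comp_smul {ω ω' : Set (ℝ × ℝ)} {u : ℝ × ℝ → ℝ} (hu : testFun ω u)
    {s : ℝ} (hs : s ≠ 0) (hω : ∀ x, s • x ∈ ω → x ∈ ω') :
    rayleigh ω' (fun x => u (s • x)) = s ^ 2 * rayleigh ω u := by
  rw [(hu.comp_smul hs hω).rayleigh_eq, hu.rayleigh_eq]
  simp only [gradSq_comp_smul, integral_const_mul]
  rw [Measure.integral_comp_smul volume (gradSq u),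
    Measure.integral_comp_smul volume (fun x => u x ^ 2)]
  simp only [smul_eq_mul]
  rw [mul_left_comm, mul_div_mul_left _ _ (by positivity), mul_div_assoc]

theorem mem_annulus_of_smul_mem {R₁ R₂ s : ℝ} (hs : 0 < s) (hs1 : s < 1) {x : ℝ × ℝ}
    (hx : s • x ∈ annulus R₁ (s * R₂)) : x ∈ annulus R₁ R₂ := by
  refine ⟨?_, fun h => hx.2 (map_mem_closure (continuous_const_smul s) h fun y hy => ?_)⟩
  · have h : (s * x.1) ^ 2 + (s * x.2) ^ 2 < (s * R₂) ^ 2 := hx.1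
    change x.1 ^ 2 + x.2 ^ 2 < R₂ ^ 2
    have h2 : s ^ 2 * (x.1 ^ 2 + x.2 ^ 2) < s ^ 2 * R₂ ^ 2 := by linarith
    exact lt_of_mul_lt_mul_left h2 (sq_nonneg s)
  · have h : y.1 ^ 2 + y.2 ^ 2 < R₁ ^ 2 := hy
    change (s * y.1) ^ 2 + (s * y.2) ^ 2 < R₁ ^ 2
    have hs2 : s ^ 2 ≤ 1 := by nlinarith
    nlinarith [mul_le_mul_of_nonneg_right hs2 (add_nonneg (sq_nonneg y.1) (sq_nonneg y.2))]

/-- `R₂ ↦ λ₁(M_{R₁,R₂})` is strictly decreasing on `(R₁, ∞)`. -/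
theorem lambda1_annulus_strictAnti (R₁ : ℝ) (hR₁ : 0 < R₁) :
    ∀ R₂ R₂' : ℝ, R₁ < R₂ → R₂ < R₂' →
      lambda1 (annulus R₁ R₂') < lambda1 (annulus R₁ R₂) := by
  intro R₂ R₂' h h'
  have hR₂ : 0 < R₂ := hR₁.trans h
  have hR₂' : 0 < R₂' := hR₂.trans h'
  set s := R₂ / R₂' with hs_def
  have hs : 0 < s := div_pos hR₂ hR₂'
  have hs1 : s < 1 := (div_lt_one hR₂').2 h'
  have hsR : R₂ = s * R₂' := by rw [hs_def]; field_simp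
  have hω : ∀ x : ℝ × ℝ, s • x ∈ annulus R₁ R₂ → x ∈ annulus R₁ R₂' := fun x hx =>
    mem_annulus_of_smul_mem hs hs1 (hsR ▸ hx)
  have hle : lambda1 (annulus R₁ R₂') / s ^ 2 ≤ lambda1 (annulus R₁ R₂) := by
    refine le_lambda1 (isOpen_annulus _ _) (annulus_nonempty hR₁ h) fun u hu h0 => ?_
    rw [div_le_iff₀' (by positivity), ← hu.rayleigh_comp_smul hs.ne' hω]
    refine lambda1_le_rayleigh (hu.comp_smul hs.ne' hω) fun hv => h0 (funext fun x => ?_)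
    simpa [smul_smul, hs.ne'] using congrFun hv (s⁻¹ • x)
  rw [div_le_iff₀' (by positivity)] at hle
  have hpos := lambda1_annulus_pos hR₁ h
  have hs2 : s ^ 2 < 1 := by nlinarith
  nlinarith
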